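/- Assume the cost tensor C has nonnegative entries and let ε > 0. If P_ε is a minimizer of MMOT-DC_ε((T_m)_{m=1}^M, μ), then KL(P_ε | (P_ε)_{#T}) ≤ (1/ε) · ⟨C, μ_1 ⊗ … ⊗ μ_N⟩. -/

import Mathlib

open scoped BigOperators

namespace MMOTPaper

variable {N M : ℕ}

/-- Frobenius inner product of two tensors. -/
def inner' {ι : Type*} [Fintype ι] (C P : ι → ℝ) : ℝ := ∑ x, C x * P x

/-- A probability tensor: nonnegative entries summing to 1. -/
def IsProb {ι : Type*} [Fintype ι] (P : ι → ℝ) : Prop :=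
  (∀ x, 0 ≤ P x) ∧ ∑ x, P x = 1

/-- Negative entropy `H(P) = ∑ P log P`. -/
noncomputable def negEnt {ι : Type*} [Fintype ι] (P : ι → ℝ) : ℝ :=
  ∑ x, P x * Real.log (P x)

/-- Kullback-Leibler divergence; `⊤` if `μ` is not absolutely continuous w.r.t. `ν`. -/
noncomputable def KL {ι : Type*} [Fintype ι] (μ ν : ι → ℝ) : EReal :=
  if ∀ x, ν x = 0 → μ x = 0 then ((∑ x, μ x * Real.log (μ x / ν x) : ℝ) : EReal)
  else ⊤

/-- `n`-th marginal vector of a tensor. -/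
def marg1 (a : Fin N → ℕ) (P : ((n : Fin N) → Fin (a n)) → ℝ) (n : Fin N)
    (i : Fin (a n)) : ℝ :=
  ∑ x : (n : Fin N) → Fin (a n), if x n = i then P x else 0

/-- The set `U_T` of admissible couplings: probability tensors with marginals `μ n`. -/
def UT (a : Fin N → ℕ) (μ : (n : Fin N) → Fin (a n) → ℝ) :
    Set (((n : Fin N) → Fin (a n)) → ℝ) :=
  {P | IsProb P ∧ ∀ n i, marg1 a P n i = μ n i}

/-- A tuple partition of `(1,…,N)` into `M` blocks, encoded by the block assignment map:
monotonicity says the blocks are tuples of consecutive indices concatenating to `T`,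
surjectivity says each block is nonempty. -/
def IsPartition (part : Fin N → Fin M) : Prop :=
  Monotone part ∧ Function.Surjective part

/-- Restriction of a full index to the coordinates of block `m`. -/
def restr (a : Fin N → ℕ) (part : Fin N → Fin M) (m : Fin M)
    (x : (n : Fin N) → Fin (a n)) : (n : {n : Fin N // part n = m}) → Fin (a n.1) :=
  fun n => x n.1

/-- The `T_m`-marginal tensor `P_{#m}` of `P`: sum over all dimensions not in block `m`. -/
def margBlock (a : Fin N → ℕ) (part : Fin N → Fin M) (m : Fin M)
    (P : ((n : Fin N) → Fin (a n)) → ℝ)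
    (y : (n : {n : Fin N // part n = m}) → Fin (a n.1)) : ℝ :=
  ∑ x : (n : Fin N) → Fin (a n), if restr a part m x = y then P x else 0

/-- Tensor product of block tensors. -/
def tprod (a : Fin N → ℕ) (part : Fin N → Fin M)
    (Q : (m : Fin M) → ((n : {n : Fin N // part n = m}) → Fin (a n.1)) → ℝ)
    (x : (n : Fin N) → Fin (a n)) : ℝ :=
  ∏ m, Q m (restr a part m x)

/-- `P_{#T}`: the tensor product of the block marginals of `P`. -/
def prodMarg (a : Fin N → ℕ) (part : Fin N → Fin M)
    (P : ((n : Fin N) → Fin (a n)) → ℝ) : ((n : Fin N) → Fin (a n)) → ℝ :=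
  tprod a part (fun m => margBlock a part m P)

/-- The product tensor `μ_1 ⊗ … ⊗ μ_N`. -/
def prodMu (a : Fin N → ℕ) (μ : (n : Fin N) → Fin (a n) → ℝ)
    (x : (n : Fin N) → Fin (a n)) : ℝ :=
  ∏ n, μ n (x n)

/-- The set `F_M` of admissible couplings factorizing as a tensor product
of probability tensors indexed by the blocks. -/
def FM (a : Fin N → ℕ) (μ : (n : Fin N) → Fin (a n) → ℝ) (part : Fin N → Fin M) :
    Set (((n : Fin N) → Fin (a n)) → ℝ) :=
  {P | P ∈ UT a μ ∧
    ∃ Q : (m : Fin M) → ((n : {n : Fin N // part n = m}) → Fin (a n.1)) → ℝ,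
      (∀ m, IsProb (Q m)) ∧ P = tprod a part Q}

/-- The MMOT value `inf_{P ∈ U_T} ⟨C, P⟩`. -/
noncomputable def MMOTval (a : Fin N → ℕ) (μ : (n : Fin N) → Fin (a n) → ℝ)
    (C : ((n : Fin N) → Fin (a n)) → ℝ) : ℝ :=
  sInf ((fun P => inner' C P) '' UT a μ)

/-- The F-MMOT value `inf_{P ∈ F_M} ⟨C, P⟩`. -/
noncomputable def FMMOTval (a : Fin N → ℕ) (μ : (n : Fin N) → Fin (a n) → ℝ)
    (part : Fin N → Fin M) (C : ((n : Fin N) → Fin (a n)) → ℝ) : ℝ :=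
  sInf ((fun P => inner' C P) '' FM a μ part)

/-- The MMOT-DC objective `⟨C, P⟩ + ε KL(P | P_{#T})`. -/
noncomputable def dcObj (a : Fin N → ℕ) (part : Fin N → Fin M)
    (C : ((n : Fin N) → Fin (a n)) → ℝ) (ε : ℝ)
    (P : ((n : Fin N) → Fin (a n)) → ℝ) : EReal :=
  ((inner' C P : ℝ) : EReal) + (ε : EReal) * KL P (prodMarg a part P)

/-- The MMOT-DC value `inf_{P ∈ U_T} ⟨C, P⟩ + ε KL(P | P_{#T})`. -/
noncomputable def MMOTDCval (a : Fin N → ℕ) (μ : (n : Fin N) → Fin (a n) → ℝ)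
    (part : Fin N → Fin M) (C : ((n : Fin N) → Fin (a n)) → ℝ) (ε : ℝ) : EReal :=
  ⨅ P ∈ UT a μ, dcObj a part C ε P

theorem sum_prodMu_cond (a : Fin N → ℕ)
    (μ : (n : Fin N) → Fin (a n) → ℝ) (hμ : ∀ n, IsProb (μ n))
    (p : Fin N → Prop) [DecidablePred p] (y : (n : Fin N) → Fin (a n)) :
    (∑ x : (n : Fin N) → Fin (a n), if (∀ n, p n → x n = y n) then prodMu a μ x else 0)
      = ∏ n, if p n then μ n (y n) else 1 := by
  have h1 : ∀ x : (n : Fin N) → Fin (a n),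
      (if (∀ n, p n → x n = y n) then prodMu a μ x else 0)
        = ∏ n, (if p n → x n = y n then μ n (x n) else 0) := by
    intro x
    split_ifs with h
    · exact Finset.prod_congr rfl fun n _ => (if_pos (h n)).symm
    · push Not at h
      obtain ⟨n, hn, hne⟩ := h
      symm
      apply Finset.prod_eq_zero (Finset.mem_univ n)
      simp [hn, hne]
  rw [Finset.sum_congr rfl fun x _ => h1 x]
  have h2 := Finset.prod_univ_sum (fun n : Fin N => (Finset.univ : Finset (Fin (a n))))
    (fun n j => if p n → j = y n then μ n j else 0)
  rw [Fintype.piFinset_univ] at h2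
  rw [← h2]
  refine Finset.prod_congr rfl fun n _ => ?_
  by_cases hp : p n
  · simp [hp]
  · simpa [hp] using (hμ n).2

theorem prodMu_mem (a : Fin N → ℕ) (ha : ∀ n, 0 < a n)
    (μ : (n : Fin N) → Fin (a n) → ℝ) (hμ : ∀ n, IsProb (μ n)) :
    prodMu a μ ∈ UT a μ := by
  refine ⟨⟨fun x => Finset.prod_nonneg fun n _ => (hμ n).1 _, ?_⟩, fun k i => ?_⟩
  · have := sum_prodMu_cond a μ hμ (fun _ => False) (fun n => ⟨0, ha n⟩)
    simpa using this
  · have := sum_prodMu_cond a μ hμ (fun n => n = k)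
      (Function.update (fun n => ⟨0, ha n⟩) k i)
    simpa [marg1] using this

theorem prodMarg_prodMu (a : Fin N → ℕ)
    (μ : (n : Fin N) → Fin (a n) → ℝ) (hμ : ∀ n, IsProb (μ n)) (part : Fin N → Fin M) :
    prodMarg a part (prodMu a μ) = prodMu a μ := by
  funext y
  have h : ∀ m, margBlock a part m (prodMu a μ) (restr a part m y)
      = ∏ n, if part n = m then μ n (y n) else 1 := by
    intro m
    rw [← sum_prodMu_cond a μ hμ (fun n => part n = m) y]
    refine Finset.sum_congr rfl fun x _ => ?_
    refine if_congr ?_ rfl rfl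
    simp [restr, funext_iff]
  unfold prodMarg tprod
  rw [Finset.prod_congr rfl fun m _ => h m, Finset.prod_comm]
  simp [prodMu]

theorem KL_self_eq_zero {ι : Type*} [Fintype ι] (P : ι → ℝ) : KL P P = 0 := by
  unfold KL
  rw [if_pos fun x h => h]
  have : ∀ x, P x * Real.log (P x / P x) = 0 := by
    intro x
    by_cases h : P x = 0 <;> simp [h]
  simp [this]

/-- If `C ≥ 0`, `ε > 0` and `P_ε` minimizes `MMOT-DC_ε`, then
`KL(P_ε | (P_ε)_{#T}) ≤ (1/ε)·⟨C, μ_1 ⊗ … ⊗ μ_N⟩`. -/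
theorem kl_of_minimizer_le {N M : ℕ} (hN : 0 < N) (hM : 0 < M)
    (a : Fin N → ℕ) (ha : ∀ n, 0 < a n)
    (μ : (n : Fin N) → Fin (a n) → ℝ) (hμ : ∀ n, IsProb (μ n))
    (part : Fin N → Fin M) (hpart : IsPartition part)
    (C : ((n : Fin N) → Fin (a n)) → ℝ) (hC : ∀ x, 0 ≤ C x)
    (ε : ℝ) (hε : 0 < ε)
    (Pe : ((n : Fin N) → Fin (a n)) → ℝ) (hPeMem : Pe ∈ UT a μ)
    (hPeMin : ∀ Q ∈ UT a μ, dcObj a part C ε Pe ≤ dcObj a part C ε Q) :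
    KL Pe (prodMarg a part Pe) ≤ (((1 / ε) * inner' C (prodMu a μ) : ℝ) : EReal) := by
  have h := hPeMin _ (prodMu_mem a ha μ hμ)
  have h0 : 0 ≤ inner' C Pe :=
    Finset.sum_nonneg fun x _ => mul_nonneg (hC x) (hPeMem.1.1 x)
  unfold dcObj at h
  rw [prodMarg_prodMu a μ hμ part, KL_self_eq_zero, mul_zero, add_zero] at h
  unfold KL at h ⊢
  split_ifs at h ⊢ with hac
  · have h' : inner' C Pe + ε * (∑ x, Pe x * Real.log (Pe x / prodMarg a part Pe x))
        ≤ inner' C (prodMu a μ) := by exact_mod_cast h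
    rw [EReal.coe_le_coe_iff, one_div, inv_mul_eq_div, le_div_iff₀ hε]
    linarith
  · rw [EReal.coe_mul_top_of_pos hε, EReal.coe_add_top] at h
    exact absurd h (by simp)

end MMOTPaper
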